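/- Let τ be a semistandard Young tableau of shape λ and weight μ and let A ∈ X̊_τ. Then the top-left (N−1)×(N−1) submatrix A_{(m, μ_m−1)} of A lies in O_{λ^{(m, μ_m−1)}}, where λ^{(m, μ_m−1)} is the shape of the tableau obtained from τ by deleting its rightmost entry equal to m (with the convention λ^{(m,0)} := λ^{(m−1)}). -/

import Mathlib

open scoped BigOperators Classical

noncomputable section

namespace Gov

/-- Extend a vector of length `m` by zeros. -/
def ext {m : ℕ} (f : Fin m → ℕ) : ℕ → ℕ := fun r => if h : r < m then f ⟨r, h⟩ else 0

/-- Offset of the `a`-th block: `μ_1 + ⋯ + μ_{a-1}`. -/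
def off {m : ℕ} (μ : Fin m → ℕ) (a : Fin m) : ℕ :=
  ∑ j ∈ Finset.univ.filter (fun j : Fin m => (j : ℕ) < (a : ℕ)), μ j

/-- Total entry access for a square matrix (zero outside the index range). -/
def ent {N : ℕ} (A : Matrix (Fin N) (Fin N) ℂ) (i j : ℕ) : ℂ :=
  if h : i < N ∧ j < N then A ⟨i, h.1⟩ ⟨j, h.2⟩ else 0

/-- Entries of the Jordan matrix `J_μ`:  `J_μ e_a^b = e_a^{b-1}`. -/
def Jent {m : ℕ} (μ : Fin m → ℕ) (i j : ℕ) : ℂ :=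
  if ∃ a : Fin m, ∃ b : ℕ, b + 1 < μ a ∧ i = off μ a + b ∧ j = off μ a + b + 1 then 1 else 0

/-- Membership in the Mirković–Vybornov slice `T_μ`. -/
def inSlice {m N : ℕ} (μ : Fin m → ℕ) (A : Matrix (Fin N) (Fin N) ℂ) : Prop :=
  ∀ s a : Fin m, ∀ t b : ℕ, t < μ s → b < μ a →
    (t + 1 < μ s ∨ (t + 1 = μ s ∧ μ s ≤ b)) →
    ent A (off μ s + t) (off μ a + b) = Jent μ (off μ s + t) (off μ a + b)

/-- Upper triangularity. -/
def upperTri {N : ℕ} (A : Matrix (Fin N) (Fin N) ℂ) : Prop :=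
  ∀ i j : Fin N, (j : ℕ) < (i : ℕ) → A i j = 0

/-- The top-left `d × d` submatrix. -/
def corner {N : ℕ} (A : Matrix (Fin N) (Fin N) ℂ) (d : ℕ) : Matrix (Fin d) (Fin d) ℂ :=
  fun i j => ent A (i : ℕ) (j : ℕ)

/-- `A` is nilpotent with Jordan type `κ` (a partition with at most `rows` parts):
`rank A^k = Σ_r max(κ_r − k, 0)` for all `k ≥ 1`. -/
def hasType {n : ℕ} (A : Matrix (Fin n) (Fin n) ℂ) (rows : ℕ) (κ : ℕ → ℕ) : Prop :=
  ∀ k : ℕ, 1 ≤ k → (A ^ k).rank = ∑ r ∈ Finset.range rows, (κ r - k)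

/-- A semistandard Young tableau of shape `lam` and weight `μ`, both with at most `m` parts,
with entries in `{1, …, m}` (rows and columns are 0-based; `entry r c = 0` outside the shape). -/
structure Tableau (m : ℕ) (lam μ : Fin m → ℕ) where
  entry : ℕ → ℕ → ℕ
  zeros : ∀ r c : ℕ, ¬ c < ext lam r → entry r c = 0
  entry_pos : ∀ r c : ℕ, c < ext lam r → 1 ≤ entry r c
  entry_le : ∀ r c : ℕ, c < ext lam r → entry r c ≤ m
  row_weak : ∀ r c c' : ℕ, c ≤ c' → c' < ext lam r → entry r c ≤ entry r c'
  col_strict : ∀ r r' c : ℕ, r < r' → c < ext lam r' → entry r c < entry r' c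
  weight : ∀ i : Fin m,
    (∑ r ∈ Finset.range m,
      ((Finset.range (ext lam r)).filter fun c => entry r c = (i : ℕ) + 1).card) = μ i

/-- Row lengths of the shape `λ^{(i)}` of the tableau obtained from `T` by deleting all
entries `> i` (here `i` is 1-based). -/
def shapeRow {m : ℕ} {lam μ : Fin m → ℕ} (T : Tableau m lam μ) (i : ℕ) : ℕ → ℕ :=
  fun r => ((Finset.range (ext lam r)).filter fun c => 1 ≤ T.entry r c ∧ T.entry r c ≤ i).card

/-- Row lengths of the shape `λ^{(i,k)}` of the tableau obtained from `T` by deleting all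
entries `> i` and all but the leftmost `k` entries equal to `i` (here `i` is 1-based). -/
def shapeRowBox {m : ℕ} {lam μ : Fin m → ℕ} (T : Tableau m lam μ) (i k : ℕ) : ℕ → ℕ :=
  fun r => ((Finset.range (ext lam r)).filter fun c =>
    (1 ≤ T.entry r c ∧ T.entry r c < i) ∨ (T.entry r c = i ∧
      ((Finset.range c).filter fun c' => ∃ r' < m, T.entry r' c' = i).card < k)).card

/-- The matrix variety `X̊_τ`. -/
def Xcirc {m : ℕ} (μ lam : Fin m → ℕ) (N : ℕ) (T : Tableau m lam μ) :
    Set (Matrix (Fin N) (Fin N) ℂ) :=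
  { A | inSlice μ A ∧ upperTri A ∧
      ∀ i : Fin m, hasType (corner A (off μ i + μ i)) m (shapeRow T ((i : ℕ) + 1)) }

/-- The Zariski topology on `N × N` complex matrices: closed sets are common zero sets of
families of polynomials in the entries. -/
def mzar (N : ℕ) : TopologicalSpace (Matrix (Fin N) (Fin N) ℂ) :=
  TopologicalSpace.generateFrom
    { U | ∃ p : MvPolynomial (Fin N × Fin N) ℂ,
        U = { A | MvPolynomial.eval (fun q => A q.1 q.2) p ≠ 0 } }

/-- Zariski closure. -/
def closureZ {N : ℕ} (S : Set (Matrix (Fin N) (Fin N) ℂ)) : Set (Matrix (Fin N) (Fin N) ℂ) :=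
  letI := mzar N
  closure S

/-- Irreducibility for the Zariski topology. -/
def isIrreducibleZ {N : ℕ} (S : Set (Matrix (Fin N) (Fin N) ℂ)) : Prop :=
  letI := mzar N
  IsIrreducible S

/-- Irreducible components of a subset: maximal irreducible subsets. -/
def irrCompsZ {N : ℕ} (S : Set (Matrix (Fin N) (Fin N) ℂ)) :
    Set (Set (Matrix (Fin N) (Fin N) ℂ)) :=
  { C | C ⊆ S ∧ isIrreducibleZ C ∧
      ∀ C', C' ⊆ S → isIrreducibleZ C' → C ⊆ C' → C' = C }

/-- Dimension of a subset: its Krull dimension as a topological space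
(with the subspace Zariski topology). -/
def dimZ {N : ℕ} (S : Set (Matrix (Fin N) (Fin N) ℂ)) : WithBot ℕ∞ :=
  letI := mzar N
  topologicalKrullDim S


section LinearAlgebra

variable {K W : Type*} [Field K] [AddCommGroup W] [Module K W]

/-- A form of Nakayama's lemma for a nilpotent endomorphism. -/
theorem le_of_le_sup_map_of_isNilpotent {f : Module.End K W} (hf : IsNilpotent f)
    {R U : Submodule K W} (hU : U.map f ≤ U) (hR : R ≤ U ⊔ R.map f) : R ≤ U := by
  have key : ∀ j : ℕ, R ≤ U ⊔ R.map (f ^ j) := by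
    intro j
    induction j with
    | zero => exact le_trans (by simp [Module.End.one_eq_id]) le_sup_right
    | succ j ih =>
      have h1 : (U ⊔ R.map (f ^ j)).map f ≤ U ⊔ R.map (f ^ (j + 1)) := by
        rw [Submodule.map_sup, pow_succ', Module.End.mul_eq_comp, Submodule.map_comp]
        exact sup_le_sup_right hU _
      exact hR.trans (sup_le le_sup_left ((Submodule.map_mono ih).trans h1))
  obtain ⟨n, hn⟩ := hf
  simpa [hn] using key n

/-- Let `U ≤ V` be invariant subspaces for a nilpotent endomorphism `f`, where `V` is a
hyperplane with `V ≤ U ⊔ range f`. Then the rank of `f ^ k` drops on `V` (by one) exactly when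
it drops on `U`. -/
theorem finrank_range_pow_eq_finrank_map_add [FiniteDimensional K W] {f : Module.End K W}
    (hf : IsNilpotent f) {U V : Submodule K W} (hU : U.map f ≤ U) (hUV : U ≤ V)
    (hV : V ≤ U ⊔ LinearMap.range f) (v : W) (hv : V ⊔ Submodule.span K {v} = ⊤) (k : ℕ) :
    Module.finrank K ((⊤ : Submodule K W).map (f ^ k)) =
      Module.finrank K (V.map (f ^ k)) +
        if Module.finrank K (U.map (f ^ k)) <
          Module.finrank K ((⊤ : Submodule K W).map (f ^ k)) then 1 else 0 := by
  have hle : V.map (f ^ k) ≤ (⊤ : Submodule K W).map (f ^ k) := Submodule.map_mono le_top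
  have h1 : Module.finrank K ((⊤ : Submodule K W).map (f ^ k)) ≤
      Module.finrank K (V.map (f ^ k)) + 1 := by
    rw [← hv, Submodule.map_sup, Submodule.map_span, Set.image_singleton]
    refine (Submodule.finrank_add_le_finrank_add_finrank _ _).trans ?_
    gcongr
    simpa using finrank_span_le_card (R := K) ({(f ^ k) v} : Set W)
  have h2 := Submodule.finrank_mono hle
  have h3 := Submodule.finrank_mono (Submodule.map_mono (f := f ^ k) hUV)
  split_ifs with h
  · by_contra hne
    have heq : V.map (f ^ k) = (⊤ : Submodule K W).map (f ^ k) :=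
      Submodule.eq_of_le_of_finrank_eq hle (by omega)
    have hcomm : ∀ X : Submodule K W, (X.map f).map (f ^ k) = (X.map (f ^ k)).map f := by
      intro X
      rw [← Submodule.map_comp, ← Submodule.map_comp, ← Module.End.mul_eq_comp,
        ← Module.End.mul_eq_comp, ← pow_succ, ← pow_succ']
    have hR : (⊤ : Submodule K W).map (f ^ k) ≤ U.map (f ^ k) := by
      refine le_of_le_sup_map_of_isNilpotent hf ?_ ?_
      · rw [← hcomm]
        exact Submodule.map_mono hU
      · rw [← hcomm, ← Submodule.map_sup, Submodule.map_top f, ← heq]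
        exact Submodule.map_mono hV
    have := Submodule.finrank_mono hR
    omega
  · omega

end LinearAlgebra

/-- The vectors supported on the first `d` coordinates. -/
def initialSubspace (N d : ℕ) : Submodule ℂ (Fin N → ℂ) where
  carrier := { w | ∀ i : Fin N, d ≤ (i : ℕ) → w i = 0 }
  add_mem' := fun ha hb i hi => by simp [ha i hi, hb i hi]
  zero_mem' := fun _ _ => rfl
  smul_mem' := fun c w hw i hi => by simp [hw i hi]

theorem mem_initialSubspace {N d : ℕ} {w : Fin N → ℂ} :
    w ∈ initialSubspace N d ↔ ∀ i : Fin N, d ≤ (i : ℕ) → w i = 0 := Iff.rfl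

/-- Extension of vectors by zero. -/
def extendZero (N d : ℕ) : (Fin d → ℂ) →ₗ[ℂ] (Fin N → ℂ) where
  toFun w i := if h : (i : ℕ) < d then w ⟨i, h⟩ else 0
  map_add' x y := by
    ext i
    by_cases h : (i : ℕ) < d <;> simp [h]
  map_smul' c x := by
    ext i
    by_cases h : (i : ℕ) < d <;> simp [h]

theorem extendZero_apply {N d : ℕ} (w : Fin d → ℂ) (i : Fin N) :
    extendZero N d w i = if h : (i : ℕ) < d then w ⟨i, h⟩ else 0 := rfl

theorem extendZero_injective {N d : ℕ} (hd : d ≤ N) : Function.Injective (extendZero N d) := by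
  intro x y hxy
  ext i
  simpa [extendZero_apply] using congrFun hxy (Fin.castLE hd i)

theorem range_extendZero {N d : ℕ} (hd : d ≤ N) :
    LinearMap.range (extendZero N d) = initialSubspace N d := by
  ext w
  constructor
  · rintro ⟨x, rfl⟩ i hi
    simp [extendZero_apply, Nat.not_lt.mpr hi]
  · intro hw
    refine ⟨fun i => w (Fin.castLE hd i), ?_⟩
    ext i
    rw [extendZero_apply]
    split_ifs with h
    · rfl
    · exact (hw i (Nat.not_lt.mp h)).symm

theorem mulVecLin_extendZero {N d : ℕ} (hd : d ≤ N) {A : Matrix (Fin N) (Fin N) ℂ}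
    (hA : upperTri A) :
    A.mulVecLin ∘ₗ extendZero N d = extendZero N d ∘ₗ (corner A d).mulVecLin := by
  refine LinearMap.ext fun w => funext fun i => ?_
  simp only [LinearMap.comp_apply, Matrix.mulVecLin_apply, Matrix.mulVec, dotProduct,
    extendZero_apply]
  have hsum : ∑ j : Fin N, A i j * (if h : (j : ℕ) < d then w ⟨j, h⟩ else 0) =
      ∑ j : Fin d, A i (Fin.castLE hd j) * w j := by
    symm
    apply Finset.sum_of_injOn (Fin.castLE hd)
    · exact (Fin.castLE_injective hd).injOn
    · simp
    · intro j _ hj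
      have : ¬ (j : ℕ) < d := fun h => hj ⟨⟨j, h⟩, by simp, rfl⟩
      simp [this]
    · simp
  rw [hsum]
  split_ifs with h
  · refine Finset.sum_congr rfl fun j _ => ?_
    have hj : (j : ℕ) < N := j.2.trans_le hd
    simp [corner, ent, hj, Fin.castLE]
  · refine Finset.sum_eq_zero fun j _ => ?_
    have := j.2
    rw [hA i (Fin.castLE hd j) (by simp; omega), zero_mul]

/-- Powers of a corner of an upper triangular matrix compute the powers on an invariant
subspace. -/
theorem rank_corner_pow {N d : ℕ} (hd : d ≤ N) {A : Matrix (Fin N) (Fin N) ℂ}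
    (hA : upperTri A) (k : ℕ) :
    ((corner A d) ^ k).rank =
      Module.finrank ℂ ((initialSubspace N d).map (A.mulVecLin ^ k)) := by
  have hpow : (A.mulVecLin ^ k) ∘ₗ extendZero N d =
      extendZero N d ∘ₗ ((corner A d).mulVecLin ^ k) :=
    LinearMap.ext fun w => by
      have hs : Function.Semiconj (extendZero N d) (corner A d).mulVecLin A.mulVecLin :=
        fun x => (LinearMap.congr_fun (mulVecLin_extendZero hd hA) x).symm
      have := (hs.iterate_right k) w
      simpa [Module.End.pow_apply] using this.symm
  have hmat : ((corner A d) ^ k).mulVecLin = (corner A d).mulVecLin ^ k := by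
    rw [← Matrix.toLin'_apply', ← Matrix.toLin'_apply', Matrix.toLin'_pow]
  rw [Matrix.rank, hmat, ← range_extendZero hd, ← LinearMap.range_comp, hpow,
    LinearMap.range_comp]
  exact (Submodule.equivMapOfInjective _ (extendZero_injective hd) _).finrank_eq

theorem corner_self {N : ℕ} (A : Matrix (Fin N) (Fin N) ℂ) : corner A N = A := by
  ext i j
  simp [corner, ent]

theorem initialSubspace_self (N : ℕ) : initialSubspace N N = ⊤ :=
  eq_top_iff.mpr fun _ _ i hi => absurd i.2 (Nat.not_lt.mpr hi)

theorem map_initialSubspace_le {N d : ℕ} (hd : d ≤ N) {A : Matrix (Fin N) (Fin N) ℂ}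
    (hA : upperTri A) : (initialSubspace N d).map A.mulVecLin ≤ initialSubspace N d := by
  rw [← range_extendZero hd, ← LinearMap.range_comp, mulVecLin_extendZero hd hA]
  exact LinearMap.range_comp_le_range _ _

/-- The last diagonal entry of a nilpotent upper triangular matrix vanishes. -/
theorem last_diag_eq_zero {N : ℕ} {A : Matrix (Fin N) (Fin N) ℂ} (hA : upperTri A)
    (hnil : IsNilpotent A) (i : Fin N) (hi : (i : ℕ) + 1 = N) : A i i = 0 := by
  have hpow : ∀ n : ℕ, (A ^ n) i i = A i i ^ n := by
    intro n
    induction n with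
    | zero => simp
    | succ n ih =>
      rw [pow_succ', pow_succ', Matrix.mul_apply, Finset.sum_eq_single i, ih]
      · intro j _ hj
        have := j.2
        have hne : (j : ℕ) ≠ i := fun h => hj (Fin.ext h)
        rw [hA i j (by omega), zero_mul]
      · simp
  obtain ⟨n, hn⟩ := hnil
  have := hpow n
  rw [hn, Matrix.zero_apply] at this
  exact IsReduced.eq_zero _ ⟨n, this.symm⟩

section Offsets

variable {m : ℕ} (μ : Fin m → ℕ)

theorem off_add_eq_sum (a : Fin m) :
    off μ a + μ a = ∑ j ∈ Finset.univ.filter (fun j : Fin m => (j : ℕ) ≤ (a : ℕ)), μ j := by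
  have : Finset.univ.filter (fun j : Fin m => (j : ℕ) ≤ (a : ℕ)) =
      insert a (Finset.univ.filter (fun j : Fin m => (j : ℕ) < (a : ℕ))) := by
    ext j
    simp [Fin.ext_iff, le_iff_eq_or_lt]
  rw [this, Finset.sum_insert (by simp), add_comm]
  rfl

theorem off_last_add (a : Fin m) (ha : (a : ℕ) + 1 = m) : off μ a + μ a = ∑ j, μ j := by
  rw [off_add_eq_sum, Finset.filter_true_of_mem]
  intro j _
  have := j.2
  omega

theorem off_succ (a b : Fin m) (hab : (b : ℕ) + 1 = a) : off μ b + μ b = off μ a := by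
  rw [off_add_eq_sum, off]
  refine Finset.sum_congr (Finset.filter_congr fun j _ => ?_) fun _ _ => rfl
  omega

end Offsets

/-- The last diagonal block of a nilpotent upper triangular matrix in the slice is a Jordan
block. -/
theorem last_block_entry {m N : ℕ} {μ : Fin m → ℕ} (a : Fin m) (ha : off μ a + μ a = N)
    {A : Matrix (Fin N) (Fin N) ℂ} (hS : inSlice μ A) (hA : upperTri A) (hnil : IsNilpotent A)
    (i j : Fin N) (hi : off μ a ≤ i) (hj : off μ a ≤ j) :
    A i j = if (j : ℕ) = i + 1 then 1 else 0 := by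
  have hi2 := i.2
  have hj2 := j.2
  by_cases hlast : (i : ℕ) + 1 = N
  · rw [if_neg (by omega)]
    by_cases hij : (j : ℕ) < i
    · exact hA i j hij
    · have : j = i := Fin.ext (by omega)
      rw [this]
      exact last_diag_eq_zero hA hnil i hlast
  · have h := hS a a (i - off μ a) (j - off μ a) (by omega) (by omega) (Or.inl (by omega))
    rw [Nat.add_sub_cancel' hi, Nat.add_sub_cancel' hj] at h
    have hent : ent A i j = A i j := by simp [ent]
    rw [← hent, h, Jent]
    refine if_congr ⟨?_, fun hji => ?_⟩ rfl rfl
    · rintro ⟨s, b, -, h1, h2⟩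
      omega
    · exact ⟨a, i - off μ a, by omega, by omega, by omega⟩

theorem initialSubspace_pred_le {m N : ℕ} {μ : Fin m → ℕ} (a : Fin m)
    (ha : off μ a + μ a = N) {A : Matrix (Fin N) (Fin N) ℂ} (hS : inSlice μ A)
    (hA : upperTri A) (hnil : IsNilpotent A) :
    initialSubspace N (N - 1) ≤ initialSubspace N (off μ a) ⊔ LinearMap.range A.mulVecLin := by
  intro w hw
  set z : Fin N → ℂ := fun j =>
    if off μ a < (j : ℕ) then w ⟨j - 1, (Nat.sub_le _ _).trans_lt j.2⟩ else 0 with hz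
  refine Submodule.mem_sup.mpr ⟨w - A.mulVecLin z, ?_, A.mulVecLin z, ⟨z, rfl⟩, by simp⟩
  intro i hi
  have hterm : ∀ j : Fin N, A i j * z j = if (j : ℕ) = i + 1 then w i else 0 := by
    intro j
    by_cases hj : off μ a < (j : ℕ)
    · rw [last_block_entry a ha hS hA hnil i j hi hj.le]
      split_ifs with h
      · simp only [hz, hj, if_true, one_mul]
        congr 1
        exact Fin.ext (by simp [h])
      · simp
    · rw [if_neg (by omega)]
      simp [hz, hj]
  have hsum : A.mulVecLin z i = w i := by
    simp only [Matrix.mulVecLin_apply, Matrix.mulVec, dotProduct, hterm]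
    by_cases hlast : (i : ℕ) + 1 < N
    · rw [Finset.sum_eq_single ⟨i + 1, hlast⟩]
      · simp
      · intro j _ hj
        rw [if_neg fun h => hj (Fin.ext h)]
      · simp
    · rw [hw i (by omega)]
      simp
  rw [Pi.sub_apply, hsum, sub_self]

theorem initialSubspace_pred_sup_span {N : ℕ} (i : Fin N) (hi : (i : ℕ) + 1 = N) :
    initialSubspace N (N - 1) ⊔ Submodule.span ℂ {Pi.single i (1 : ℂ)} = ⊤ := by
  refine eq_top_iff.mpr fun w _ => Submodule.mem_sup.mpr
    ⟨w - w i • Pi.single i (1 : ℂ), ?_, w i • Pi.single i (1 : ℂ),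
      Submodule.smul_mem _ _ (Submodule.mem_span_singleton_self _), by simp⟩
  intro j hj
  have : j = i := Fin.ext (by have := j.2; omega)
  subst this
  simp

section Tableaux

variable {m : ℕ} {lam μ : Fin m → ℕ} (T : Tableau m lam μ)

theorem Tableau.lt_ext_of_entry_eq (hm : 1 ≤ m) {r c : ℕ} (h : T.entry r c = m) :
    c < ext lam r := by
  by_contra hc
  have := T.zeros r c hc
  omega

theorem Tableau.row_eq_of_entry_eq (hm : 1 ≤ m) {r r' c : ℕ} (h : T.entry r c = m)
    (h' : T.entry r' c = m) : r = r' := by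
  rcases lt_trichotomy r r' with hr | hr | hr
  · have := T.col_strict r r' c hr (T.lt_ext_of_entry_eq hm h')
    omega
  · exact hr
  · have := T.col_strict r' r c hr (T.lt_ext_of_entry_eq hm h)
    omega

theorem shapeRow_full (r : ℕ) : shapeRow T m r = ext lam r := by
  rw [shapeRow, Finset.filter_true_of_mem, Finset.card_range]
  intro c hc
  have hc := Finset.mem_range.mp hc
  exact ⟨T.entry_pos r c hc, T.entry_le r c hc⟩

/-- The columns containing the largest entry `m`. -/
def maxColumns : Finset ℕ :=
  ((Finset.range m).sigma fun r =>
    (Finset.range (ext lam r)).filter fun c => T.entry r c = m).image fun x => x.2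

theorem mem_maxColumns (hm : 1 ≤ m) {c : ℕ} :
    c ∈ maxColumns T ↔ ∃ r < m, T.entry r c = m := by
  simp only [maxColumns, Finset.mem_image, Finset.mem_sigma, Finset.mem_range,
    Finset.mem_filter, Sigma.exists]
  constructor
  · rintro ⟨r, c', ⟨hr, -, h⟩, rfl⟩
    exact ⟨r, hr, h⟩
  · rintro ⟨r, hr, h⟩
    exact ⟨r, c, ⟨hr, T.lt_ext_of_entry_eq hm h, h⟩, rfl⟩

theorem card_maxColumns (a : Fin m) (ha : (a : ℕ) + 1 = m) : (maxColumns T).card = μ a := by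
  rw [maxColumns, Finset.card_image_of_injOn, Finset.card_sigma, ← T.weight a, ha]
  rintro ⟨r, c⟩ h ⟨r', c'⟩ h' hcc
  simp only [Finset.coe_sigma, Set.mem_sigma_iff, Finset.mem_coe, Finset.mem_filter] at h h' hcc
  subst hcc
  rw [T.row_eq_of_entry_eq (by omega) h.2.2 h'.2.2]

/-- The rightmost box with the largest entry ends its row, and removing it produces
`λ^{(m, μ_m - 1)}`. -/
theorem exists_rightmost_box (a : Fin m) (ha : (a : ℕ) + 1 = m) (hpos : 1 ≤ μ a) :
    ∃ r₀ < m, ∃ p : ℕ, T.entry r₀ p = m ∧ ext lam r₀ = p + 1 ∧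
      (∀ r < m, ∀ c, T.entry r c = m → c ≤ p) ∧
      ∀ r < m, shapeRowBox T m (μ a - 1) r = ext lam r - if r = r₀ then 1 else 0 := by
  have hm : 1 ≤ m := by omega
  have hcard := card_maxColumns T a ha
  have hne : (maxColumns T).Nonempty := by
    rw [← Finset.card_pos]
    omega
  set p := (maxColumns T).max' hne
  have hpM : p ∈ maxColumns T := Finset.max'_mem _ _
  have hmax : ∀ r < m, ∀ c, T.entry r c = m → c ≤ p := fun r hr c h =>
    Finset.le_max' _ _ ((mem_maxColumns T hm).mpr ⟨r, hr, h⟩)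
  obtain ⟨r₀, hr₀, hr₀p⟩ := (mem_maxColumns T hm).mp hpM
  have hlt := T.lt_ext_of_entry_eq hm hr₀p
  have hext : ext lam r₀ = p + 1 := by
    by_contra hne'
    have h1 := T.row_weak r₀ p (p + 1) (by omega) (by omega)
    have h2 := T.entry_le r₀ (p + 1) (by omega)
    have := hmax r₀ hr₀ (p + 1) (by omega)
    omega
  have hcount : ∀ c ∈ maxColumns T,
      (((Finset.range c).filter fun c' => ∃ r' < m, T.entry r' c' = m).card < μ a - 1 ↔
        c ≠ p) := by
    intro c hc
    have hset : (Finset.range c).filter (fun c' => ∃ r' < m, T.entry r' c' = m) =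
        (maxColumns T).filter (fun c' => c' < c) := by
      ext c'
      rw [Finset.mem_filter, Finset.mem_filter, mem_maxColumns T hm, Finset.mem_range, and_comm]
    rw [hset]
    constructor
    · rintro h rfl
      have : (maxColumns T).erase p ⊆ (maxColumns T).filter (fun c' => c' < p) := by
        intro c' hc'
        obtain ⟨h1, h2⟩ := Finset.mem_erase.mp hc'
        exact Finset.mem_filter.mpr ⟨h2, lt_of_le_of_ne (Finset.le_max' _ _ h2) h1⟩
      have := Finset.card_le_card this
      rw [Finset.card_erase_of_mem hpM] at this
      omega
    · intro hcp
      have hcp' : c < p := lt_of_le_of_ne (Finset.le_max' _ _ hc) hcp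
      have hsub : (maxColumns T).filter (fun c' => c' < c) ⊂ (maxColumns T).erase p := by
        refine Finset.ssubset_iff_subset_ne.mpr ⟨fun c' hc' => ?_, fun heq => ?_⟩
        · obtain ⟨h1, h2⟩ := Finset.mem_filter.mp hc'
          exact Finset.mem_erase.mpr ⟨by omega, h1⟩
        · have : c ∈ (maxColumns T).erase p := Finset.mem_erase.mpr ⟨hcp, hc⟩
          rw [← heq] at this
          simp at this
      have := Finset.card_lt_card hsub
      rw [Finset.card_erase_of_mem hpM] at this
      omega
  refine ⟨r₀, hr₀, p, hr₀p, hext, hmax, fun r hr => ?_⟩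
  have hbox : ∀ c < ext lam r, (((1 ≤ T.entry r c ∧ T.entry r c < m) ∨ (T.entry r c = m ∧
      ((Finset.range c).filter fun c' => ∃ r' < m, T.entry r' c' = m).card < μ a - 1)) ↔
        ¬ (r = r₀ ∧ c = p)) := by
    intro c hc
    have h1 := T.entry_pos r c hc
    have h2 := T.entry_le r c hc
    by_cases h : T.entry r c = m
    · rw [hcount c ((mem_maxColumns T hm).mpr ⟨r, hr, h⟩)]
      have : c = p → r = r₀ := by
        rintro rfl
        exact T.row_eq_of_entry_eq hm h hr₀p
      constructor
      · rintro (h' | h')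
        · omega
        · exact fun h'' => h'.2 h''.2
      · exact fun h' => Or.inr ⟨h, fun h'' => h' ⟨this h'', h''⟩⟩
    · refine iff_of_true (Or.inl ⟨h1, by omega⟩) ?_
      rintro ⟨rfl, rfl⟩
      exact h hr₀p
  rw [shapeRowBox, Finset.filter_congr fun c hc => hbox c (Finset.mem_range.mp hc)]
  by_cases hr' : r = r₀
  · subst hr'
    have : (Finset.range (ext lam r)).filter (fun c => ¬ (r = r ∧ c = p)) =
        Finset.range p := by
      ext c
      simp only [Finset.mem_filter, Finset.mem_range, hext, true_and]
      omega
    rw [this, hext]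
    simp
  · simp [hr']

/-- The sizes of the shapes beyond column `k`. -/
theorem sum_shapeRowBox_add (a : Fin m) (ha : (a : ℕ) + 1 = m) (hpos : 1 ≤ μ a) (k : ℕ) :
    ∑ r ∈ Finset.range m, (ext lam r - k) =
      ∑ r ∈ Finset.range m, (shapeRowBox T m (μ a - 1) r - k) +
        if ∑ r ∈ Finset.range m, (shapeRow T (m - 1) r - k) <
          ∑ r ∈ Finset.range m, (ext lam r - k) then 1 else 0 := by
  obtain ⟨r₀, hr₀, p, hr₀p, hext, hmax, hbox⟩ := exists_rightmost_box T a ha hpos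
  have hle : ∀ r, shapeRow T (m - 1) r ≤ ext lam r := fun r =>
    (Finset.card_filter_le _ _).trans (Finset.card_range _).le
  have hiff : (∑ r ∈ Finset.range m, (shapeRow T (m - 1) r - k) <
      ∑ r ∈ Finset.range m, (ext lam r - k)) ↔ k ≤ p := by
    constructor
    · intro h
      by_contra hk
      refine h.ne (Finset.sum_congr rfl fun r hr => ?_)
      have hr := Finset.mem_range.mp hr
      by_cases hrk : ext lam r ≤ k
      · have := hle r
        omega
      · have : shapeRow T (m - 1) r = ext lam r := by
          rw [shapeRow, Finset.filter_true_of_mem, Finset.card_range]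
          intro c hc
          have hc := Finset.mem_range.mp hc
          have h1 := T.entry_pos r c hc
          have h2 := T.row_weak r c (ext lam r - 1) (by omega) (by omega)
          have h3 := T.entry_le r (ext lam r - 1) (by omega)
          have h4 : T.entry r (ext lam r - 1) ≠ m := fun h => by
            have := hmax r hr _ h
            omega
          omega
        rw [this]
    · intro hk
      refine Finset.sum_lt_sum (fun r _ => Nat.sub_le_sub_right (hle r) k)
        ⟨r₀, Finset.mem_range.mpr hr₀, ?_⟩
      have : shapeRow T (m - 1) r₀ < ext lam r₀ := by
        conv_rhs => rw [← Finset.card_range (ext lam r₀)]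
        refine Finset.card_lt_card (Finset.filter_ssubset.mpr
          ⟨p, Finset.mem_range.mpr (by omega), ?_⟩)
        omega
      omega
  rw [if_congr hiff rfl rfl, ← Finset.add_sum_erase _ _ (Finset.mem_range.mpr hr₀),
    ← Finset.add_sum_erase _ (fun r => shapeRowBox T m (μ a - 1) r - k)
      (Finset.mem_range.mpr hr₀)]
  have hrest : ∑ r ∈ (Finset.range m).erase r₀, (shapeRowBox T m (μ a - 1) r - k) =
      ∑ r ∈ (Finset.range m).erase r₀, (ext lam r - k) := by
    refine Finset.sum_congr rfl fun r hr => ?_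
    obtain ⟨h1, h2⟩ := Finset.mem_erase.mp hr
    rw [hbox r (Finset.mem_range.mp h2), if_neg h1, Nat.sub_zero]
  rw [hrest, hbox r₀ hr₀, if_pos rfl, hext]
  split_ifs <;> omega

end Tableaux

/-- The corner complementary to the last block has the type of the tableau without its largest
entries. -/
theorem hasType_corner_off {m N : ℕ} {lam μ : Fin m → ℕ} (T : Tableau m lam μ)
    {A : Matrix (Fin N) (Fin N) ℂ} (hA : A ∈ Xcirc μ lam N T) (a : Fin m)
    (ha : (a : ℕ) + 1 = m) : hasType (corner A (off μ a)) m (shapeRow T (m - 1)) := by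
  by_cases h0 : (a : ℕ) = 0
  · have hoff : off μ a = 0 := by simp [off, h0]
    have hm : m - 1 = 0 := by omega
    rw [hoff, hm]
    intro k _
    have hz : ∀ r, shapeRow T 0 r = 0 := by
      intro r
      rw [shapeRow, Finset.card_eq_zero, Finset.filter_eq_empty_iff]
      intro c _
      omega
    have := Matrix.rank_le_width (corner A 0 ^ k)
    simp only [hz]
    simpa using this
  · have hb : (a : ℕ) - 1 < m := by omega
    have := hA.2.2 ⟨a - 1, hb⟩
    rw [off_succ μ a ⟨a - 1, hb⟩ (by simp; omega)] at this
    have h1 : (a : ℕ) - 1 + 1 = m - 1 := by omega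
    simpa only [h1] using this

/-- If `A ∈ X̊_τ` then the top-left `(N−1) × (N−1)` submatrix of `A` has
Jordan type `λ^{(m, μ_m − 1)}`, the shape of the tableau obtained from `τ` by deleting its
rightmost entry equal to `m`. -/
theorem stmt4 (m : ℕ) (hm : 1 ≤ m) (μ : Fin m → ℕ)
    (hμmono : ∀ i j : Fin m, i ≤ j → μ j ≤ μ i) (hμpos : ∀ i : Fin m, 1 ≤ μ i)
    (N : ℕ) (hN : N = ∑ j, μ j)
    (lam : Fin m → ℕ) (hlammono : ∀ i j : Fin m, i ≤ j → lam j ≤ lam i)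
    (hlamsum : ∑ j, lam j = N)
    (T : Tableau m lam μ)
    (A : Matrix (Fin N) (Fin N) ℂ) (hA : A ∈ Xcirc μ lam N T) :
    hasType (corner A (N - 1)) m (shapeRowBox T m (μ ⟨m - 1, by omega⟩ - 1)) := by
  set a : Fin m := ⟨m - 1, by omega⟩ with ha'
  have ha : (a : ℕ) + 1 = m := by simp [ha']; omega
  have hNa : off μ a + μ a = N := by rw [hN, off_last_add μ a ha]
  have hpos := hμpos a
  obtain ⟨hS, hU, hT⟩ := id hA
  have htop : ∀ k : ℕ, 1 ≤ k → (A ^ k).rank = ∑ r ∈ Finset.range m, (ext lam r - k) := by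
    intro k hk
    have := hT a
    rw [hNa, corner_self, ha] at this
    simpa only [shapeRow_full] using this k hk
  have hnil : IsNilpotent A := by
    refine ⟨N, ?_⟩
    have h0 : (A ^ N).rank = 0 := by
      rw [htop N (by omega)]
      refine Finset.sum_eq_zero fun r hr => ?_
      have hle : lam ⟨r, Finset.mem_range.mp hr⟩ ≤ N := by
        rw [← hlamsum]
        exact Finset.single_le_sum (fun _ _ => Nat.zero_le _) (Finset.mem_univ _)
      simp only [ext, Finset.mem_range.mp hr, dif_pos]
      omega
    rw [Matrix.rank, Submodule.finrank_eq_zero, LinearMap.range_eq_bot,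
      ← Matrix.toLin'_apply'] at h0
    exact (LinearEquiv.map_eq_zero_iff Matrix.toLin').mp h0
  have hnil' : IsNilpotent A.mulVecLin := by
    obtain ⟨n, hn⟩ := hnil
    refine ⟨n, ?_⟩
    rw [← Matrix.toLin'_apply', ← Matrix.toLin'_pow, hn, map_zero]
  intro k hk
  have h1 := finrank_range_pow_eq_finrank_map_add hnil'
    (map_initialSubspace_le (d := off μ a) (by omega) hU)
    (V := initialSubspace N (N - 1)) (fun w hw i hi => hw i (by omega))
    (initialSubspace_pred_le a hNa hS hU hnil) _
    (initialSubspace_pred_sup_span ⟨N - 1, by omega⟩ (by simp; omega)) k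
  rw [← rank_corner_pow (by omega) hU, ← rank_corner_pow (by omega) hU,
    ← initialSubspace_self, ← rank_corner_pow le_rfl hU, corner_self, htop k hk,
    hasType_corner_off T hA a ha k hk] at h1
  have h2 := sum_shapeRowBox_add T a ha hpos k
  omega

end Gov
end
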